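/- Let h be a Hessenberg function on {1,…,n}, let c₁, c₂ ∈ ℂ with c₁ ≠ c₂, and let s' = diag(c₁, c₂, c₂, …, c₂) and s = diag(1, 0, …, 0). Then I_{s',h} = I_{s,h}. -/

import Mathlib

open MvPolynomial

noncomputable section

/-- The polynomial ring `R = ℂ[z_{ij} : 1 ≤ i,j ≤ n]` (indices 0-based). -/
abbrev R (n : ℕ) : Type := MvPolynomial (Fin n × Fin n) ℂ

/-- The ideal `L_i = ⟨z_{11}, …, z_{1i}⟩` (first row, first `i` variables; 0-based columns `j < i`).
    `Lideal n 0 = ⟨0⟩`. -/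
def Lideal (n : ℕ) [NeZero n] (i : ℕ) : Ideal (R n) :=
  Ideal.span { p | ∃ j : Fin n, (j : ℕ) < i ∧ p = X ((0 : Fin n), j) }

/-- The ideal `K_j`, generated by the `j × j` minors `p_B = det((z_{kℓ})_{k ∈ B, 1 ≤ ℓ ≤ j})`
    over all `j`-element subsets `B ⊆ {2, …, n}` (0-based: rows `B k ≠ 0`, columns `0,…,j-1`).
    For `j = n` (or `j > n`) there are no such subsets and the ideal is `⟨0⟩`. -/
def Kideal (n : ℕ) (j : ℕ) : Ideal (R n) :=
  Ideal.span { p | ∃ (hj : j ≤ n) (B : Fin j → Fin n), StrictMono B ∧ (∀ k, (B k : ℕ) ≠ 0) ∧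
    p = (Matrix.of fun k l : Fin j => (X (B k, Fin.castLE hj l) : R n)).det }

/-- A Hessenberg function (0-based): `h` is monotone with `h i ≥ i` for all `i`. -/
def IsHessenberg (n : ℕ) (h : Fin n → Fin n) : Prop := Monotone h ∧ ∀ i, i ≤ h i

/-- `i` is a corner of `h`, i.e. (1-based) `h(i) > h(i-1)` with the convention `h(0) = 0`;
    0-based, `i = 0` is always a corner. -/
def HessCorner (n : ℕ) (h : Fin n → Fin n) (i : Fin n) : Prop :=
  (i : ℕ) = 0 ∨ h ⟨(i : ℕ) - 1, lt_of_le_of_lt (Nat.sub_le _ _) i.isLt⟩ < h i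

/-- The `n × (i + h(i))` matrix with columns `x·v_1, …, x·v_i, v_1, …, v_{h(i)}`,
    where `v_j` is the `j`-th column of the generic matrix `Z`. Here (0-based) the paper's
    `i` is `a+1` and the paper's `h(i)` is `(h a) + 1`. -/
def hessMat (n : ℕ) (x : Matrix (Fin n) (Fin n) ℂ) (h : Fin n → Fin n) (a : Fin n) :
    Matrix (Fin n) (Fin ((a : ℕ) + 1) ⊕ Fin (((h a) : ℕ) + 1)) (R n) :=
  Matrix.of fun r c => Sum.elim
    (fun c' => ∑ k : Fin n, MvPolynomial.C (x r k) * X (k, Fin.castLE a.isLt c'))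
    (fun c' => X (r, Fin.castLE (h a).isLt c')) c

/-- The ideal `I_{x,h,i}` generated by all `(h(i)+1) × (h(i)+1)` minors of `hessMat`
    (paper's `h(i)+1` is `(h a) + 2` 0-based). -/
def hessIdealAt (n : ℕ) (x : Matrix (Fin n) (Fin n) ℂ) (h : Fin n → Fin n) (a : Fin n) :
    Ideal (R n) :=
  Ideal.span { p | ∃ (f : Fin (((h a) : ℕ) + 2) → Fin n)
    (g : Fin (((h a) : ℕ) + 2) → Fin ((a : ℕ) + 1) ⊕ Fin (((h a) : ℕ) + 1)),
    p = ((hessMat n x h a).submatrix f g).det }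

/-- The ideal `I_{x,h} = Σ_{i=1}^n I_{x,h,i}`. -/
def hessIdeal (n : ℕ) (x : Matrix (Fin n) (Fin n) ℂ) (h : Fin n → Fin n) : Ideal (R n) :=
  ∑ a : Fin n, hessIdealAt n x h a

/-- The minimal semisimple element `s = diag(1, 0, …, 0)`. -/
def sMat (n : ℕ) [NeZero n] : Matrix (Fin n) (Fin n) ℂ :=
  Matrix.diagonal (fun i => if i = 0 then 1 else 0)

/-- The rank `r_{pq}(w)` of the top-left `(p+1) × (q+1)` (0-based) submatrix of the
    permutation matrix of `w`. -/
def rankpq (n : ℕ) (w : Equiv.Perm (Fin n)) (p q : Fin n) : ℕ :=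
  (Finset.univ.filter fun j : Fin n => j ≤ q ∧ w j ≤ p).card

/-- The Schubert determinantal ideal `I_w`: generated, over all `p, q`, by the minors of size
    `1 + r_{pq}(w)` of the top-left `(p+1) × (q+1)` (0-based) submatrix of the generic matrix. -/
def schubertIdeal (n : ℕ) (w : Equiv.Perm (Fin n)) : Ideal (R n) :=
  Ideal.span { m | ∃ (p q : Fin n) (f g : Fin (rankpq n w p q + 1) → Fin n),
    (∀ k, f k ≤ p) ∧ (∀ k, g k ≤ q) ∧
    m = (Matrix.of fun k l => (X (f k, g l) : R n)).det }

/-- The generic matrix `Z`. -/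
def genZ (n : ℕ) : Matrix (Fin n) (Fin n) (R n) :=
  Matrix.of fun k l => X (k, l)

/-- A minor of `A * T`, where repeated rows and columns are allowed, is a linear combination
of minors of `A` with the same rows. -/
theorem det_submatrix_mul_mem {S ι κ τ : Type*} [CommRing S] [Fintype κ] {m : ℕ}
    (A : Matrix ι κ S) (T : Matrix κ τ S) (I : Ideal S) (f : Fin m → ι) (g : Fin m → τ)
    (hI : ∀ r : Fin m → κ, (A.submatrix f r).det ∈ I) :
    ((A * T).submatrix f g).det ∈ I := by
  classical
  have hrows : ((A * T).submatrix f g).transpose =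
      fun i => ∑ k : κ, T k (g i) • fun j => A (f j) k := by
    funext i j
    simp [Matrix.mul_apply, Finset.sum_apply, mul_comm]
  rw [← Matrix.det_transpose, hrows]
  change Matrix.detRowAlternating.toMultilinearMap _ ∈ I
  rw [MultilinearMap.map_sum]
  refine Ideal.sum_mem _ fun r _ => ?_
  rw [MultilinearMap.map_smul_univ]
  refine Ideal.mul_mem_left _ _ ?_
  have h := hI r
  rw [← Matrix.det_transpose] at h
  exact h

/-- Replacing `y` by `α • y + β • 1` multiplies `hessMat` on the right by a matrix. -/
theorem exists_hessMat_eq_mul (n : ℕ) (h : Fin n → Fin n) (a : Fin n) (ha : a ≤ h a)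
    (y : Matrix (Fin n) (Fin n) ℂ) (α β : ℂ) :
    ∃ T : Matrix (Fin ((a : ℕ) + 1) ⊕ Fin ((h a : ℕ) + 1))
        (Fin ((a : ℕ) + 1) ⊕ Fin ((h a : ℕ) + 1)) (R n),
      hessMat n (α • y + β • 1) h a = hessMat n y h a * T := by
  have hle : (a : ℕ) + 1 ≤ (h a : ℕ) + 1 := Nat.succ_le_succ ha
  refine ⟨Matrix.fromBlocks ((C α : R n) • 1) 0
    (Matrix.of fun k c => if k = Fin.castLE hle c then C β else 0) 1, ?_⟩
  refine Matrix.ext fun r c => ?_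
  rcases c with c | c
  · rw [Matrix.mul_apply, Fintype.sum_sum_type]
    simp [hessMat, Matrix.one_apply, add_mul, Finset.sum_add_distrib, Finset.sum_mul,
      apply_ite C]
    rw [mul_comm (C β)]
    exact congrArg (· + _) (Finset.sum_congr rfl fun k _ => by ring)
  · rw [Matrix.mul_apply, Fintype.sum_sum_type]
    simp [hessMat, Matrix.one_apply]

theorem hessIdealAt_le_of_eq_smul_add (n : ℕ) (h : Fin n → Fin n) (a : Fin n) (ha : a ≤ h a)
    (x y : Matrix (Fin n) (Fin n) ℂ) (α β : ℂ) (hxy : x = α • y + β • 1) :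
    hessIdealAt n x h a ≤ hessIdealAt n y h a := by
  subst hxy
  refine Ideal.span_le.2 ?_
  rintro p ⟨f, g, rfl⟩
  obtain ⟨T, hT⟩ := exists_hessMat_eq_mul n h a ha y α β
  rw [hT]
  exact det_submatrix_mul_mem _ _ _ _ _ fun r => Ideal.subset_span ⟨f, r, rfl⟩

/-- from Section 4: for `s' = diag(c₁, c₂, …, c₂)` with `c₁ ≠ c₂` and
`s = diag(1, 0, …, 0)`, the ideals `I_{s',h}` and `I_{s,h}` coincide. -/
theorem stmt19 (n : ℕ) [NeZero n] (h : Fin n → Fin n) (hh : IsHessenberg n h)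
    (c₁ c₂ : ℂ) (hc : c₁ ≠ c₂) :
    hessIdeal n (Matrix.diagonal (fun i : Fin n => if i = 0 then c₁ else c₂)) h =
      hessIdeal n (sMat n) h := by
  have hd : c₁ - c₂ ≠ 0 := sub_ne_zero.2 hc
  refine Finset.sum_congr rfl fun a _ => le_antisymm ?_ ?_
  · refine hessIdealAt_le_of_eq_smul_add n h a (hh.2 a) _ _ (c₁ - c₂) c₂ ?_
    ext i j
    by_cases hij : i = j <;> by_cases hi : i = 0 <;>
      simp_all [sMat]
  · refine hessIdealAt_le_of_eq_smul_add n h a (hh.2 a) _ _ (c₁ - c₂)⁻¹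
      (-((c₁ - c₂)⁻¹ * c₂)) ?_
    ext i j
    by_cases hij : i = j
    · subst hij
      by_cases hi : i = 0
      · simp [sMat, hi]
        field_simp
        ring
      · simp [sMat, hi]
    · simp [sMat, hij]
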